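/- Let H be a cocommutative weak Hopf algebra and A a commutative weak Hopf algebra, with H acting on A via a functional λ (h·a = λ(h)a) and A coacting on H via a group-like idempotent z (ρ(h) = h⊗z), so that (H,A) is a compatible weak matched pair and A♯♯H is a weak Hopf algebra. If α is a left integral in A and t is a left integral in H, then the condition (h·α)εs((t₁)¹(t₂·1_A)) ⊗ (t₁)⁰ = (h⁰·1_A)εs(h¹)·α·εs((t₁)¹(t₂·1_A)) ⊗ (t₁)⁰ holds in A⊗H for all h ∈ H; consequently α♯♯t = αz # λ(t₁)t₂ is a left integral in the weak Hopf algebra A♯♯H. -/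

import Mathlib

open TensorProduct

noncomputable section

namespace WeakSmash

variable (k : Type*) [Field k]

/-- A weak bialgebra structure on the `k`-algebra `H`. -/
structure WeakBialgebra (H : Type*) [Ring H] [Algebra k H] where
  comul : H →ₗ[k] H ⊗[k] H
  counit : H →ₗ[k] k
  coassoc : ∀ h : H,
    (TensorProduct.assoc k H H H) ((LinearMap.rTensor H comul) (comul h)) =
      (LinearMap.lTensor H comul) (comul h)
  counit_comul : ∀ h : H,
    (TensorProduct.lid k H) ((LinearMap.rTensor H counit) (comul h)) = h
  comul_counit : ∀ h : H,
    (TensorProduct.rid k H) ((LinearMap.lTensor H counit) (comul h)) = h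
  comul_mul : ∀ h g : H, comul (h * g) = comul h * comul g
  counit_weak : ∀ h g l : H,
    counit (h * g * l) =
      LinearMap.mul' k k
        ((TensorProduct.map (counit ∘ₗ LinearMap.mulLeft k h)
            (counit ∘ₗ LinearMap.mulRight k l)) (comul g))
  counit_weak' : ∀ h g l : H,
    counit (h * g * l) =
      LinearMap.mul' k k
        ((TensorProduct.map (counit ∘ₗ LinearMap.mulLeft k h)
            (counit ∘ₗ LinearMap.mulRight k l)) ((TensorProduct.comm k H H) (comul g)))
  comul_one_left :
    ((TensorProduct.assoc k H H H) (comul 1 ⊗ₜ[k] (1 : H))) * ((1 : H) ⊗ₜ[k] comul 1) =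
      (LinearMap.lTensor H comul) (comul 1)
  comul_one_right :
    ((1 : H) ⊗ₜ[k] comul 1) * ((TensorProduct.assoc k H H H) (comul 1 ⊗ₜ[k] (1 : H))) =
      (LinearMap.lTensor H comul) (comul 1)

variable {k}

namespace WeakBialgebra

variable {H : Type*} [Ring H] [Algebra k H]

/-- The target counital map `εt h = ε(1₁ h) 1₂`. -/
def εt (W : WeakBialgebra k H) : H →ₗ[k] H :=
  (TensorProduct.lid k H).toLinearMap ∘ₗ LinearMap.rTensor H W.counit ∘ₗ
    LinearMap.mulLeft k (W.comul 1) ∘ₗ (TensorProduct.mk k H H).flip 1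

/-- The source counital map `εs h = 1₁ ε(h 1₂)`. -/
def εs (W : WeakBialgebra k H) : H →ₗ[k] H :=
  (TensorProduct.rid k H).toLinearMap ∘ₗ LinearMap.lTensor H W.counit ∘ₗ
    LinearMap.mulRight k (W.comul 1) ∘ₗ TensorProduct.mk k H H 1

/-- Cocommutativity of a weak bialgebra. -/
def Cocomm (W : WeakBialgebra k H) : Prop :=
  ∀ h : H, (TensorProduct.comm k H H) (W.comul h) = W.comul h

/-- `S` is an antipode for `W`, making it a weak Hopf algebra. -/
structure IsAntipode (W : WeakBialgebra k H) (S : H →ₗ[k] H) : Prop where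
  mul_antipode : ∀ h : H,
    LinearMap.mul' k H ((LinearMap.lTensor H S) (W.comul h)) = W.εt h
  antipode_mul : ∀ h : H,
    LinearMap.mul' k H ((LinearMap.rTensor H S) (W.comul h)) = W.εs h
  antipode_mid : ∀ h : H,
    LinearMap.mul' k H
      ((TensorProduct.map S (LinearMap.mul' k H ∘ₗ LinearMap.lTensor H S))
        ((LinearMap.lTensor H W.comul) (W.comul h))) = S h

/-- `α` is a left integral: `h α = εt(h) α`. -/
def IsLeftIntegral (W : WeakBialgebra k H) (α : H) : Prop :=
  ∀ h : H, h * α = W.εt h * α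

end WeakBialgebra

section MatchedPair

variable (k)
variable {H A : Type*} [Ring H] [Algebra k H] [Ring A] [Algebra k A]

/-- `A` is a left `H`-module algebra via the action `act`. -/
structure IsModuleAlgebra (WH : WeakBialgebra k H) (act : H →ₗ[k] A →ₗ[k] A) : Prop where
  one_act : ∀ a : A, act 1 a = a
  act_mul : ∀ (h : H) (a b : A),
    act h (a * b) =
      LinearMap.mul' k A ((TensorProduct.map (act.flip a) (act.flip b)) (WH.comul h))
  act_act : ∀ (h g : H) (a : A), act h (act g a) = act (h * g) a
  act_unit : ∀ h : H, act h 1 = act (WH.εt h) 1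

/-- The map `h ↦ ε(h⁰) h¹`. -/
def coactCounit (WH : WeakBialgebra k H) (coact : H →ₗ[k] H ⊗[k] A) : H →ₗ[k] A :=
  (TensorProduct.lid k A).toLinearMap ∘ₗ LinearMap.rTensor A WH.counit ∘ₗ coact

/-- `H` is a right `A`-comodule coalgebra via the coaction `coact`. -/
structure IsComoduleCoalgebra (WH : WeakBialgebra k H) (WA : WeakBialgebra k A)
    (coact : H →ₗ[k] H ⊗[k] A) : Prop where
  counit_coact : ∀ h : H,
    (TensorProduct.rid k H) ((LinearMap.lTensor H WA.counit) (coact h)) = h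
  comul_coact : ∀ h : H,
    (LinearMap.rTensor A WH.comul) (coact h) =
      (LinearMap.lTensor (H ⊗[k] H) (LinearMap.mul' k A))
        ((TensorProduct.tensorTensorTensorComm k H A H A)
          ((TensorProduct.map coact coact) (WH.comul h)))
  coact_coact : ∀ h : H,
    (TensorProduct.assoc k H A A) ((LinearMap.rTensor A coact) (coact h)) =
      (LinearMap.lTensor H WA.comul) (coact h)
  coact_counit : ∀ h : H,
    coactCounit k WH coact h = WA.εs (coactCounit k WH coact h)

/-- The map `(h₁ ⊗ h₂) ⊗ (x₁ ⊗ x₂) ↦ (h₁⁰ · x₁) ⊗ (h₁¹ (h₂ · x₂))`. -/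
def pairMapA (act : H →ₗ[k] A →ₗ[k] A) (coact : H →ₗ[k] H ⊗[k] A) :
    (H ⊗[k] H) ⊗[k] (A ⊗[k] A) →ₗ[k] A ⊗[k] A :=
  LinearMap.lTensor A (LinearMap.mul' k A) ∘ₗ
  (TensorProduct.assoc k A A A).toLinearMap ∘ₗ
  LinearMap.rTensor A
    (LinearMap.rTensor A (TensorProduct.lift act) ∘ₗ
      (TensorProduct.assoc k H A A).symm.toLinearMap ∘ₗ
      LinearMap.lTensor H (TensorProduct.comm k A A).toLinearMap ∘ₗ
      (TensorProduct.assoc k H A A).toLinearMap) ∘ₗ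
  TensorProduct.map (LinearMap.rTensor A coact) (TensorProduct.lift act) ∘ₗ
  (TensorProduct.tensorTensorTensorComm k H H A A).toLinearMap

/-- The map `(h₁ ⊗ h₂) ⊗ (g⁰ ⊗ g¹) ↦ (h₁⁰ g⁰) ⊗ (h₁¹ (h₂ · g¹))`. -/
def pairMapH (act : H →ₗ[k] A →ₗ[k] A) (coact : H →ₗ[k] H ⊗[k] A) :
    (H ⊗[k] H) ⊗[k] (H ⊗[k] A) →ₗ[k] H ⊗[k] A :=
  LinearMap.lTensor H (LinearMap.mul' k A) ∘ₗ
  (TensorProduct.assoc k H A A).toLinearMap ∘ₗ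
  LinearMap.rTensor A
    (LinearMap.rTensor A (LinearMap.mul' k H) ∘ₗ
      (TensorProduct.assoc k H H A).symm.toLinearMap ∘ₗ
      LinearMap.lTensor H (TensorProduct.comm k A H).toLinearMap ∘ₗ
      (TensorProduct.assoc k H A H).toLinearMap) ∘ₗ
  TensorProduct.map (LinearMap.rTensor H coact) (TensorProduct.lift act) ∘ₗ
  (TensorProduct.tensorTensorTensorComm k H H H A).toLinearMap

/-- The iterated comultiplication `h ↦ h₁ ⊗ (h₂ ⊗ h₃)`. -/
def twoComul (WH : WeakBialgebra k H) : H →ₗ[k] H ⊗[k] (H ⊗[k] H) :=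
  LinearMap.lTensor H WH.comul ∘ₗ WH.comul

/-- The iterated comultiplication `h ↦ h₁ ⊗ (h₂ ⊗ (h₃ ⊗ h₄))`. -/
def threeComul (WH : WeakBialgebra k H) : H →ₗ[k] H ⊗[k] (H ⊗[k] (H ⊗[k] H)) :=
  LinearMap.lTensor H (LinearMap.lTensor H WH.comul) ∘ₗ LinearMap.lTensor H WH.comul ∘ₗ WH.comul

/-- Left-hand side of the matched pair condition (iii):
`(h₁·x)₁ ⊗ (h₂ g)⁰ ⊗ (h₁·x)₂ (h₂ g)¹`. -/
def mpLHS (WH : WeakBialgebra k H) (WA : WeakBialgebra k A)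
    (act : H →ₗ[k] A →ₗ[k] A) (coact : H →ₗ[k] H ⊗[k] A) (h g : H) (x : A) :
    (A ⊗[k] H) ⊗[k] A :=
  LinearMap.lTensor (A ⊗[k] H) (LinearMap.mul' k A)
    ((TensorProduct.tensorTensorTensorComm k A A H A)
      ((TensorProduct.map (WA.comul ∘ₗ act.flip x) (coact ∘ₗ LinearMap.mulRight k g))
        (WH.comul h)))

/-- Right-hand side of the matched pair condition (iii):
`(h₁⁰ · x₁) ⊗ (h₃⁰ g⁰) ⊗ (h₁¹ (h₂ · x₂) h₃¹ (h₄ · g¹))`. -/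
def mpRHS (WH : WeakBialgebra k H) (WA : WeakBialgebra k A)
    (act : H →ₗ[k] A →ₗ[k] A) (coact : H →ₗ[k] H ⊗[k] A) (h g : H) (x : A) :
    (A ⊗[k] H) ⊗[k] A :=
  LinearMap.lTensor (A ⊗[k] H) (LinearMap.mul' k A)
    ((TensorProduct.tensorTensorTensorComm k A A H A)
      ((TensorProduct.map
          (pairMapA k act coact ∘ₗ
            (TensorProduct.mk k (H ⊗[k] H) (A ⊗[k] A)).flip (WA.comul x))
          (pairMapH k act coact ∘ₗ
            (TensorProduct.mk k (H ⊗[k] H) (H ⊗[k] A)).flip (coact g)))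
        ((TensorProduct.assoc k H H (H ⊗[k] H)).symm (threeComul k WH h))))

/-- `(H, A)` is a weak matched pair. -/
structure IsWeakMatchedPair (WH : WeakBialgebra k H) (WA : WeakBialgebra k A)
    (act : H →ₗ[k] A →ₗ[k] A) (coact : H →ₗ[k] H ⊗[k] A) : Prop where
  moduleAlgebra : IsModuleAlgebra k WH act
  comoduleCoalgebra : IsComoduleCoalgebra k WH WA coact
  cond3 : ∀ (h g : H) (x : A),
    mpLHS k WH WA act coact h g x = mpRHS k WH WA act coact h g x
  cond4 : ∀ (h : H) (x : A), WA.εs (act h x) = WA.εs (act h 1) * WA.εs x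
  cond5 :
    (LinearMap.rTensor H coact) (WH.comul 1) =
      (TensorProduct.map (LinearMap.lTensor H (coactCounit k WH coact))
          (LinearMap.mul' k H))
        ((TensorProduct.tensorTensorTensorComm k H H H H)
          (WH.comul 1 ⊗ₜ[k] WH.comul 1))

/-- `(H, A)` is a compatible (abelian) weak matched pair. -/
structure IsCompatiblePair (WH : WeakBialgebra k H) (WA : WeakBialgebra k A)
    (act : H →ₗ[k] A →ₗ[k] A) (coact : H →ₗ[k] H ⊗[k] A) : Prop where
  pair : IsWeakMatchedPair k WH WA act coact
  cocomm : WH.Cocomm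
  comm : ∀ a b : A, a * b = b * a
  compat1 : ∀ h : H,
    act h 1 =
      (TensorProduct.rid k A)
        ((TensorProduct.map (TensorProduct.lift act)
            (WA.counit ∘ₗ TensorProduct.lift act))
          ((TensorProduct.tensorTensorTensorComm k H H A A)
            (WH.comul h ⊗ₜ[k] WA.comul 1)))
  compat2 : ∀ h g : H,
    (TensorProduct.map (act h) (act g)) (WA.comul 1) =
      (TensorProduct.map (LinearMap.mulLeft k (act h 1))
        (LinearMap.mulLeft k (act g 1))) (WA.comul 1)

/-- The smash product multiplication on `A ⊗ H`:
`(x ⊗ h) (y ⊗ g) = x (h₁ · y) ⊗ h₂ g`. -/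
def smashMul (WH : WeakBialgebra k H) (act : H →ₗ[k] A →ₗ[k] A) :
    (A ⊗[k] H) ⊗[k] (A ⊗[k] H) →ₗ[k] A ⊗[k] H :=
  LinearMap.rTensor H (LinearMap.mul' k A) ∘ₗ
  (TensorProduct.assoc k A A H).symm.toLinearMap ∘ₗ
  LinearMap.lTensor A
    (TensorProduct.map (TensorProduct.lift act) (LinearMap.mul' k H) ∘ₗ
      (TensorProduct.tensorTensorTensorComm k H H A H).toLinearMap) ∘ₗ
  (TensorProduct.assoc k A (H ⊗[k] H) (A ⊗[k] H)).toLinearMap ∘ₗ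
  LinearMap.rTensor (A ⊗[k] H) (LinearMap.lTensor A WH.comul)

/-- The smash coproduct on `A ⊗ H`:
`Δ(x ⊗ h) = (x₁ ⊗ h₁⁰) ⊗ (x₂ h₁¹ ⊗ h₂)`. -/
def smashComul (WH : WeakBialgebra k H) (WA : WeakBialgebra k A)
    (coact : H →ₗ[k] H ⊗[k] A) :
    A ⊗[k] H →ₗ[k] (A ⊗[k] H) ⊗[k] (A ⊗[k] H) :=
  (TensorProduct.assoc k (A ⊗[k] H) A H).toLinearMap ∘ₗ
  LinearMap.rTensor H (LinearMap.lTensor (A ⊗[k] H) (LinearMap.mul' k A)) ∘ₗ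
  LinearMap.rTensor H (TensorProduct.tensorTensorTensorComm k A A H A).toLinearMap ∘ₗ
  (TensorProduct.assoc k (A ⊗[k] A) (H ⊗[k] A) H).symm.toLinearMap ∘ₗ
  LinearMap.lTensor (A ⊗[k] A) (LinearMap.rTensor H coact) ∘ₗ
  TensorProduct.map WA.comul WH.comul

/-- The smash counit `ε(x ⊗ h) = ε(x) ε(h)`. -/
def smashCounit (WH : WeakBialgebra k H) (WA : WeakBialgebra k A) :
    A ⊗[k] H →ₗ[k] k :=
  LinearMap.mul' k k ∘ₗ TensorProduct.map WA.counit WH.counit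

/-- The projection `u ↦ u (1_A # 1_H)` onto `A ♯ H`. -/
def projUnder (WH : WeakBialgebra k H) (act : H →ₗ[k] A →ₗ[k] A) :
    A ⊗[k] H →ₗ[k] A ⊗[k] H :=
  smashMul k WH act ∘ₗ
    (TensorProduct.mk k (A ⊗[k] H) (A ⊗[k] H)).flip ((1 : A) ⊗ₜ[k] (1 : H))

/-- The projection `u ↦ (id ⊗ ε) Δ(u)` onto `overline(A # H)`. -/
def projBar (WH : WeakBialgebra k H) (WA : WeakBialgebra k A)
    (coact : H →ₗ[k] H ⊗[k] A) : A ⊗[k] H →ₗ[k] A ⊗[k] H :=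
  (TensorProduct.rid k (A ⊗[k] H)).toLinearMap ∘ₗ
    LinearMap.lTensor (A ⊗[k] H) (smashCounit k WH WA) ∘ₗ smashComul k WH WA coact

/-- The projection onto `A ♯♯ H`, i.e. `u ↦ (id ⊗ ε) Δ (u (1#1))`. -/
def projBoth (WH : WeakBialgebra k H) (WA : WeakBialgebra k A)
    (act : H →ₗ[k] A →ₗ[k] A) (coact : H →ₗ[k] H ⊗[k] A) :
    A ⊗[k] H →ₗ[k] A ⊗[k] H :=
  projBar k WH WA coact ∘ₗ projUnder k WH act

/-- Componentwise smash multiplication on `(A⊗H) ⊗ (A⊗H)`. -/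
def smashMul2 (WH : WeakBialgebra k H) (act : H →ₗ[k] A →ₗ[k] A) :
    ((A ⊗[k] H) ⊗[k] (A ⊗[k] H)) ⊗[k] ((A ⊗[k] H) ⊗[k] (A ⊗[k] H)) →ₗ[k]
      (A ⊗[k] H) ⊗[k] (A ⊗[k] H) :=
  TensorProduct.map (smashMul k WH act) (smashMul k WH act) ∘ₗ
    (TensorProduct.tensorTensorTensorComm k (A ⊗[k] H) (A ⊗[k] H)
      (A ⊗[k] H) (A ⊗[k] H)).toLinearMap

/-- Componentwise smash multiplication on threefold tensors. -/
def smashMul3 (WH : WeakBialgebra k H) (act : H →ₗ[k] A →ₗ[k] A) :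
    ((A ⊗[k] H) ⊗[k] ((A ⊗[k] H) ⊗[k] (A ⊗[k] H))) ⊗[k]
      ((A ⊗[k] H) ⊗[k] ((A ⊗[k] H) ⊗[k] (A ⊗[k] H))) →ₗ[k]
      (A ⊗[k] H) ⊗[k] ((A ⊗[k] H) ⊗[k] (A ⊗[k] H)) :=
  TensorProduct.map (smashMul k WH act) (smashMul2 k WH act) ∘ₗ
    (TensorProduct.tensorTensorTensorComm k (A ⊗[k] H)
      ((A ⊗[k] H) ⊗[k] (A ⊗[k] H)) (A ⊗[k] H)
      ((A ⊗[k] H) ⊗[k] (A ⊗[k] H))).toLinearMap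

/-- The unit element `1_A ♯♯ 1_H` of `A ♯♯ H`. -/
def smashOne (WH : WeakBialgebra k H) (WA : WeakBialgebra k A)
    (act : H →ₗ[k] A →ₗ[k] A) (coact : H →ₗ[k] H ⊗[k] A) : A ⊗[k] H :=
  projBoth k WH WA act coact ((1 : A) ⊗ₜ[k] (1 : H))

/-- The map `εt` of the weak bialgebra `A ♯♯ H`: `u ↦ ε(e₁ u) e₂` where `e = 1_A ♯♯ 1_H`. -/
def smashEpsT (WH : WeakBialgebra k H) (WA : WeakBialgebra k A)
    (act : H →ₗ[k] A →ₗ[k] A) (coact : H →ₗ[k] H ⊗[k] A) (u : A ⊗[k] H) :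
    A ⊗[k] H :=
  (TensorProduct.lid k (A ⊗[k] H))
    ((LinearMap.rTensor (A ⊗[k] H)
        (smashCounit k WH WA ∘ₗ smashMul k WH act ∘ₗ
          (TensorProduct.mk k (A ⊗[k] H) (A ⊗[k] H)).flip u))
      (smashComul k WH WA coact (smashOne k WH WA act coact)))

/-- The map `εs` of the weak bialgebra `A ♯♯ H`: `u ↦ e₁ ε(u e₂)` where `e = 1_A ♯♯ 1_H`. -/
def smashEpsS (WH : WeakBialgebra k H) (WA : WeakBialgebra k A)
    (act : H →ₗ[k] A →ₗ[k] A) (coact : H →ₗ[k] H ⊗[k] A) (u : A ⊗[k] H) :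
    A ⊗[k] H :=
  (TensorProduct.rid k (A ⊗[k] H))
    ((LinearMap.lTensor (A ⊗[k] H)
        (smashCounit k WH WA ∘ₗ smashMul k WH act ∘ₗ
          TensorProduct.mk k (A ⊗[k] H) (A ⊗[k] H) u))
      (smashComul k WH WA coact (smashOne k WH WA act coact)))

/-- The antipode of `A ♯♯ H`:
`S(x ⊗ h) = (1_A ♯♯ S_H(h⁰)) ((S_A(x h¹)) ♯♯ 1_H)`. -/
def smashAntipode (WH : WeakBialgebra k H) (WA : WeakBialgebra k A)
    (act : H →ₗ[k] A →ₗ[k] A) (coact : H →ₗ[k] H ⊗[k] A)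
    (SH : H →ₗ[k] H) (SA : A →ₗ[k] A) : A ⊗[k] H →ₗ[k] A ⊗[k] H :=
  smashMul k WH act ∘ₗ
  TensorProduct.map
    (projBoth k WH WA act coact ∘ₗ TensorProduct.mk k A H 1)
    (projBoth k WH WA act coact ∘ₗ (TensorProduct.mk k A H).flip 1) ∘ₗ
  (TensorProduct.comm k A H).toLinearMap ∘ₗ
  TensorProduct.map (SA ∘ₗ LinearMap.mul' k A) SH ∘ₗ
  (TensorProduct.assoc k A A H).symm.toLinearMap ∘ₗ
  LinearMap.lTensor A ((TensorProduct.comm k H A).toLinearMap ∘ₗ coact)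

/-- LHS of condition (7): `(1_{H1} h⁰ · 1_A) ⊗ S_A(h¹) εs(1_{H2}¹) ⊗ 1_{H2}⁰`. -/
def cond7LHS (WH : WeakBialgebra k H) (WA : WeakBialgebra k A)
    (act : H →ₗ[k] A →ₗ[k] A) (coact : H →ₗ[k] H ⊗[k] A)
    (SA : A →ₗ[k] A) (h : H) : (A ⊗[k] A) ⊗[k] H :=
  (TensorProduct.assoc k A A H).symm
    ((TensorProduct.map
        (act.flip 1 ∘ₗ LinearMap.mul' k H)
        ((TensorProduct.comm k H A).toLinearMap ∘ₗ
          LinearMap.lTensor H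
            (LinearMap.mul' k A ∘ₗ TensorProduct.map SA WA.εs ∘ₗ
              (TensorProduct.comm k A A).toLinearMap) ∘ₗ
          (TensorProduct.assoc k H A A).toLinearMap ∘ₗ
          LinearMap.rTensor A coact))
      ((TensorProduct.tensorTensorTensorComm k H H H A)
        (WH.comul 1 ⊗ₜ[k] coact h)))

/-- RHS of condition (7):
`εt(1_{H1}⁰ h⁰ · 1_A) ⊗ εt(h¹) εs(1_{H2}¹) 1_{H1}¹ ⊗ 1_{H2}⁰`. -/
def cond7RHS (WH : WeakBialgebra k H) (WA : WeakBialgebra k A)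
    (act : H →ₗ[k] A →ₗ[k] A) (coact : H →ₗ[k] H ⊗[k] A) (h : H) :
    (A ⊗[k] A) ⊗[k] H :=
  (TensorProduct.assoc k A A H).symm
   ((LinearMap.lTensor A (TensorProduct.comm k H A).toLinearMap)
    ((TensorProduct.assoc k A H A)
     ((LinearMap.lTensor (A ⊗[k] H)
        (LinearMap.mul' k A ∘ₗ (TensorProduct.comm k A A).toLinearMap))
      ((TensorProduct.tensorTensorTensorComm k A A H A)
       ((LinearMap.lTensor (A ⊗[k] A) (TensorProduct.comm k A H).toLinearMap)
        ((TensorProduct.map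
            (LinearMap.rTensor A (WA.εt ∘ₗ act.flip 1 ∘ₗ LinearMap.mul' k H) ∘ₗ
              (TensorProduct.assoc k H H A).symm.toLinearMap ∘ₗ
              LinearMap.lTensor H (TensorProduct.comm k A H).toLinearMap ∘ₗ
              (TensorProduct.assoc k H A H).toLinearMap)
            (LinearMap.rTensor H
                (LinearMap.mul' k A ∘ₗ (TensorProduct.comm k A A).toLinearMap ∘ₗ
                  TensorProduct.map WA.εs WA.εt) ∘ₗ
              (TensorProduct.assoc k A A H).symm.toLinearMap ∘ₗ
              LinearMap.lTensor A (TensorProduct.comm k H A).toLinearMap ∘ₗ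
              (TensorProduct.assoc k A H A).toLinearMap ∘ₗ
              LinearMap.rTensor A (TensorProduct.comm k H A).toLinearMap))
          ((TensorProduct.tensorTensorTensorComm k (H ⊗[k] A) (H ⊗[k] A) H A)
            (((TensorProduct.map coact coact) (WH.comul 1)) ⊗ₜ[k] coact h))))))))

/-- LHS of condition (8):
`εs(h₁¹ h₂¹) (S_H(h₁⁰) · 1_A) ⊗ S_H(h₂⁰) h₃`. -/
def cond8LHS (WH : WeakBialgebra k H) (WA : WeakBialgebra k A)
    (act : H →ₗ[k] A →ₗ[k] A) (coact : H →ₗ[k] H ⊗[k] A)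
    (SH : H →ₗ[k] H) (h : H) : A ⊗[k] H :=
  LinearMap.rTensor H (LinearMap.mul' k A)
   ((TensorProduct.assoc k A A H).symm
    ((TensorProduct.map
        (WA.εs ∘ₗ LinearMap.mul' k A)
        (TensorProduct.map (act.flip 1 ∘ₗ SH)
          (LinearMap.mul' k H ∘ₗ LinearMap.rTensor H SH)))
      ((TensorProduct.tensorTensorTensorComm k A H A (H ⊗[k] H))
        ((TensorProduct.map (TensorProduct.comm k H A).toLinearMap
            ((TensorProduct.assoc k A H H).toLinearMap ∘ₗ
              LinearMap.rTensor H (TensorProduct.comm k H A).toLinearMap))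
          ((TensorProduct.map coact (LinearMap.rTensor H coact))
            (twoComul k WH h))))))

/-- RHS of condition (8):
`εs(h¹ 1_{H2}¹) εs(h⁰ 1_{H1} · 1_A) ⊗ 1_{H2}⁰`. -/
def cond8RHS (WH : WeakBialgebra k H) (WA : WeakBialgebra k A)
    (act : H →ₗ[k] A →ₗ[k] A) (coact : H →ₗ[k] H ⊗[k] A) (h : H) :
    A ⊗[k] H :=
  LinearMap.rTensor H (LinearMap.mul' k A ∘ₗ (TensorProduct.comm k A A).toLinearMap)
   ((TensorProduct.assoc k A A H).symm
    ((TensorProduct.map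
        (WA.εs ∘ₗ act.flip 1 ∘ₗ LinearMap.mul' k H)
        (LinearMap.rTensor H (WA.εs ∘ₗ LinearMap.mul' k A) ∘ₗ
          (TensorProduct.assoc k A A H).symm.toLinearMap ∘ₗ
          LinearMap.lTensor A (TensorProduct.comm k H A).toLinearMap))
      ((TensorProduct.tensorTensorTensorComm k H A H (H ⊗[k] A))
        (coact h ⊗ₜ[k] (LinearMap.lTensor H coact) (WH.comul 1)))))

/-- The element `εs(t₁¹ (t₂ · 1_A)) ⊗ t₁⁰` of `A ⊗ H`. -/
def integralWitness (WH : WeakBialgebra k H) (WA : WeakBialgebra k A)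
    (act : H →ₗ[k] A →ₗ[k] A) (coact : H →ₗ[k] H ⊗[k] A) (t : H) :
    A ⊗[k] H :=
  (TensorProduct.comm k H A)
    ((LinearMap.lTensor H (WA.εs ∘ₗ LinearMap.mul' k A))
      ((TensorProduct.assoc k H A A)
        ((LinearMap.rTensor A coact)
          ((LinearMap.lTensor H (act.flip 1)) (WH.comul t)))))

end MatchedPair

end WeakSmash


namespace WeakSmash

section Counit

variable {k A : Type*} [Field k] [Ring A] [Algebra k A] (W : WeakBialgebra k A)

theorem WeakBialgebra.εs_apply (y : A) :
    W.εs y = TensorProduct.rid k A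
      (LinearMap.lTensor A (W.counit ∘ₗ LinearMap.mulLeft k y) (W.comul 1)) := by
  simp only [WeakBialgebra.εs, LinearMap.comp_apply, LinearMap.mulRight_apply,
    TensorProduct.mk_apply, LinearEquiv.coe_coe]
  congr 1
  induction W.comul 1 with
  | zero => simp
  | tmul a b => simp
  | add a b ha hb => simp only [mul_add, map_add, ha, hb]

theorem WeakBialgebra.εt_apply (y : A) :
    W.εt y = TensorProduct.lid k A
      (LinearMap.rTensor A (W.counit ∘ₗ LinearMap.mulRight k y) (W.comul 1)) := by
  simp only [WeakBialgebra.εt, LinearMap.comp_apply, LinearMap.mulLeft_apply,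
    LinearMap.flip_apply, TensorProduct.mk_apply, LinearEquiv.coe_coe]
  congr 1
  induction W.comul 1 with
  | zero => simp
  | tmul a b => simp
  | add a b ha hb => simp only [add_mul, map_add, ha, hb]

theorem WeakBialgebra.counit_mul_eq (x y : A) :
    W.counit (x * y) = LinearMap.mul' k k
      (TensorProduct.map (W.counit ∘ₗ LinearMap.mulLeft k x)
        (W.counit ∘ₗ LinearMap.mulRight k y) (W.comul 1)) := by
  rw [← W.counit_weak, mul_one]

theorem assoc_mul (u v : (A ⊗[k] A) ⊗[k] A) :
    TensorProduct.assoc k A A A (u * v) =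
      TensorProduct.assoc k A A A u * TensorProduct.assoc k A A A v :=
  map_mul (Algebra.TensorProduct.assoc k k k A A A) u v

/-- `x₁ ε(x₂ y) = x 1₁ ε(1₂ y)`. -/
theorem WeakBialgebra.comul_counit_mul_right (x y : A) :
    TensorProduct.rid k A
        (LinearMap.lTensor A (W.counit ∘ₗ LinearMap.mulRight k y) (W.comul x)) =
      x * TensorProduct.rid k A
        (LinearMap.lTensor A (W.counit ∘ₗ LinearMap.mulRight k y) (W.comul 1)) := by
  set f := W.counit ∘ₗ LinearMap.mulRight k y
  let Θ : A ⊗[k] (A ⊗[k] A) →ₗ[k] A := (TensorProduct.rid k A).toLinearMap ∘ₗ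
    LinearMap.lTensor A (LinearMap.mul' k k ∘ₗ TensorProduct.map W.counit f)
  have h1 : ∀ D : A ⊗[k] A,
      Θ (TensorProduct.assoc k A A A (D ⊗ₜ 1) * ((1 : A) ⊗ₜ W.comul 1)) =
        TensorProduct.rid k A (LinearMap.lTensor A f D) := by
    intro D
    induction D with
    | zero => simp
    | add a b ha hb => simp only [add_tmul, map_add, add_mul, ha, hb]
    | tmul c e =>
      have : f e = LinearMap.mul' k k
          (TensorProduct.map (W.counit ∘ₗ LinearMap.mulLeft k e) f (W.comul 1)) :=
        W.counit_mul_eq e y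
      rw [LinearMap.lTensor_tmul, this]
      induction W.comul 1 with
      | zero => simp
      | add a b ha hb =>
        simp only [tmul_add, map_add, mul_add, ha, hb]
      | tmul a b => simp [Θ]
  have h2 : ∀ D : A ⊗[k] A,
      Θ (TensorProduct.assoc k A A A
        ((W.comul x ⊗ₜ 1) * LinearMap.rTensor A W.comul D)) =
        x * TensorProduct.rid k A (LinearMap.lTensor A f D) := by
    intro D
    induction D with
    | zero => simp
    | add a b ha hb => simp only [mul_add, map_add, ha, hb]
    | tmul p r =>
      have h3 := W.comul_counit (x * p)
      rw [LinearMap.rTensor_tmul, Algebra.TensorProduct.tmul_mul_tmul, ← W.comul_mul, one_mul,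
        LinearMap.lTensor_tmul, TensorProduct.rid_tmul, mul_smul_comm]
      conv_rhs => rw [← h3]
      induction W.comul (x * p) with
      | zero => simp
      | add a b ha hb => simp only [add_tmul, map_add, smul_add, ha, hb]
      | tmul a b => simp [Θ, smul_smul, mul_comm]
  rw [← h2, ← h1, assoc_mul, W.coassoc, ← W.comul_one_left, ← mul_assoc, ← assoc_mul,
    Algebra.TensorProduct.tmul_mul_tmul, ← W.comul_mul, mul_one, mul_one]

/-- `ε(x y₁) y₂ = ε(x 1₁) 1₂ y`. -/
theorem WeakBialgebra.counit_mul_comul_left (x y : A) :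
    TensorProduct.lid k A
        (LinearMap.rTensor A (W.counit ∘ₗ LinearMap.mulLeft k x) (W.comul y)) =
      TensorProduct.lid k A
        (LinearMap.rTensor A (W.counit ∘ₗ LinearMap.mulLeft k x) (W.comul 1)) * y := by
  set g := W.counit ∘ₗ LinearMap.mulLeft k x
  let Θ : A ⊗[k] (A ⊗[k] A) →ₗ[k] A := (TensorProduct.lid k A).toLinearMap ∘ₗ
    TensorProduct.map g ((TensorProduct.lid k A).toLinearMap ∘ₗ LinearMap.rTensor A W.counit)
  have h1 : ∀ D : A ⊗[k] A,
      Θ (TensorProduct.assoc k A A A (W.comul 1 ⊗ₜ 1) * ((1 : A) ⊗ₜ D)) =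
        TensorProduct.lid k A (LinearMap.rTensor A g D) := by
    intro D
    induction D with
    | zero => simp
    | add a b ha hb => simp only [tmul_add, map_add, mul_add, ha, hb]
    | tmul c e =>
      have : g c = LinearMap.mul' k k
          (TensorProduct.map g (W.counit ∘ₗ LinearMap.mulRight k c) (W.comul 1)) :=
        W.counit_mul_eq x c
      rw [LinearMap.rTensor_tmul, this]
      induction W.comul 1 with
      | zero => simp
      | add a b ha hb =>
        simp only [add_tmul, map_add, add_mul, ha, hb]
      | tmul a b => simp [Θ, smul_smul, mul_comm]
  have h2 : ∀ D : A ⊗[k] A,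
      Θ (LinearMap.lTensor A W.comul D * ((1 : A) ⊗ₜ W.comul y)) =
        TensorProduct.lid k A (LinearMap.rTensor A g D) * y := by
    intro D
    induction D with
    | zero => simp
    | add a b ha hb => simp only [add_mul, map_add, ha, hb]
    | tmul p r =>
      simp [Θ, ← W.comul_mul, W.counit_comul]
  rw [← h2, ← h1, ← W.comul_one_left, mul_assoc,
    Algebra.TensorProduct.tmul_mul_tmul, ← W.comul_mul, mul_one, one_mul]

section GroupLike

variable {W} {S : A →ₗ[k] A} {z : A}

theorem WeakBialgebra.εs_eq_self_of_comul_eq (hS : W.IsAntipode S)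
    (hcomm : ∀ a b : A, a * b = b * a) (hz1 : W.counit z = 1) (hz2 : z * z = z)
    (hz3 : W.comul z = z ⊗ₜ[k] z) : W.εs z = z := by
  have h1 : W.εs z = S z * z := by
    rw [← hS.antipode_mul, hz3]; simp
  have h2 : z = z * W.εs z := by
    have := W.comul_counit_mul_right z z
    rw [hz3] at this
    rw [W.εs_apply, show LinearMap.mulLeft k z = LinearMap.mulRight k z from
      LinearMap.ext fun a => hcomm z a, ← this]
    simp [hz2, hz1]
  calc W.εs z = z * W.εs z := by rw [h1, hcomm z, mul_assoc, hz2]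
    _ = z := h2.symm

theorem WeakBialgebra.comul_counit_mul_groupLike (hS : W.IsAntipode S)
    (hcomm : ∀ a b : A, a * b = b * a) (hz1 : W.counit z = 1) (hz2 : z * z = z)
    (hz3 : W.comul z = z ⊗ₜ[k] z) (x : A) :
    TensorProduct.rid k A
      (LinearMap.lTensor A (W.counit ∘ₗ LinearMap.mulRight k z) (W.comul x)) = x * z := by
  rw [W.comul_counit_mul_right, show LinearMap.mulRight k z = LinearMap.mulLeft k z from
      LinearMap.ext fun a => hcomm a z, ← W.εs_apply,
    WeakBialgebra.εs_eq_self_of_comul_eq hS hcomm hz1 hz2 hz3]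

theorem WeakBialgebra.εt_mul_groupLike (hcomm : ∀ a b : A, a * b = b * a)
    (hz3 : W.comul z = z ⊗ₜ[k] z) (x : A) :
    W.εt x * z = W.counit (x * z) • z := by
  rw [W.εt_apply, show LinearMap.mulRight k x = LinearMap.mulLeft k x from
      LinearMap.ext fun a => hcomm a x, ← W.counit_mul_comul_left, hz3]
  simp

end GroupLike

end Counit

section Twist

variable {k H : Type*} [Field k] [Ring H] [Algebra k H] (W : WeakBialgebra k H)
  (lam : H →ₗ[k] k)

/-- The map `h ↦ λ(h₁) h₂`. -/
def twist : H →ₗ[k] H :=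
  (TensorProduct.lid k H).toLinearMap ∘ₗ LinearMap.rTensor H lam ∘ₗ W.comul

theorem twist_apply (h : H) :
    twist W lam h = TensorProduct.lid k H (LinearMap.rTensor H lam (W.comul h)) := rfl

theorem twist_mul (hlam3 : ∀ h g : H, lam (h * g) = lam h * lam g) (h g : H) :
    twist W lam (h * g) = twist W lam h * twist W lam g := by
  rw [twist_apply, twist_apply, twist_apply, W.comul_mul]
  induction W.comul h with
  | zero => simp
  | add a b ha hb => simp only [add_mul, map_add, ha, hb]
  | tmul a b =>
    induction W.comul g with
    | zero => simp
    | add c d hc hd => simp only [mul_add, map_add, hc, hd]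
    | tmul c d => simp [hlam3, smul_smul, mul_comm]

theorem counit_twist (h : H) : W.counit (twist W lam h) = lam h := by
  conv_rhs => rw [← W.comul_counit h]
  rw [twist_apply]
  induction W.comul h with
  | zero => simp
  | add a b ha hb => simp only [map_add, ha, hb]
  | tmul a b => simp [mul_comm]

theorem twist_twist
    (hlam2 : ∀ h : H, LinearMap.mul' k k (TensorProduct.map lam lam (W.comul h)) = lam h)
    (h : H) : twist W lam (twist W lam h) = twist W lam h := by
  let Θ : H ⊗[k] (H ⊗[k] H) →ₗ[k] H := (TensorProduct.lid k H).toLinearMap ∘ₗ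
    TensorProduct.map lam ((TensorProduct.lid k H).toLinearMap ∘ₗ LinearMap.rTensor H lam)
  have h1 : ∀ D : H ⊗[k] H, Θ (LinearMap.lTensor H W.comul D) =
      twist W lam (TensorProduct.lid k H (LinearMap.rTensor H lam D)) := by
    intro D
    induction D with
    | zero => simp
    | add a b ha hb => simp only [map_add, ha, hb]
    | tmul a b => simp [Θ, twist_apply]
  have h2 : ∀ D : H ⊗[k] H,
      Θ (TensorProduct.assoc k H H H (LinearMap.rTensor H W.comul D)) =
      TensorProduct.lid k H (LinearMap.rTensor H lam D) := by
    intro D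
    induction D with
    | zero => simp
    | add a b ha hb => simp only [map_add, ha, hb]
    | tmul a b =>
      rw [LinearMap.rTensor_tmul, LinearMap.rTensor_tmul, ← hlam2 a]
      induction W.comul a with
      | zero => simp
      | add c d hc hd => simp only [add_tmul, map_add, hc, hd]
      | tmul c d => simp [Θ, smul_smul, mul_comm]
  rw [twist_apply W lam h, ← h1, ← W.coassoc, h2]

theorem lTensor_twist_comul (hcoc : W.Cocomm) (h : H) :
    LinearMap.lTensor H (twist W lam) (W.comul h) =
      LinearMap.rTensor H (twist W lam) (W.comul h) := by
  have h0 : ∀ a, twist W lam a =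
      TensorProduct.rid k H (LinearMap.lTensor H lam (W.comul a)) := by
    intro a
    rw [twist_apply]
    conv_lhs => rw [← hcoc a]
    induction W.comul a with
    | zero => simp
    | add c d hc hd => simp only [map_add, hc, hd]
    | tmul c d => simp
  let Θ : H ⊗[k] (H ⊗[k] H) →ₗ[k] H ⊗[k] H :=
    LinearMap.lTensor H ((TensorProduct.lid k H).toLinearMap ∘ₗ LinearMap.rTensor H lam)
  have h1 : ∀ D : H ⊗[k] H, Θ (LinearMap.lTensor H W.comul D) =
      LinearMap.lTensor H (twist W lam) D := by
    intro D
    induction D with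
    | zero => simp
    | add a b ha hb => simp only [map_add, ha, hb]
    | tmul a b => simp [Θ, twist_apply]
  have h2 : ∀ D : H ⊗[k] H,
      Θ (TensorProduct.assoc k H H H (LinearMap.rTensor H W.comul D)) =
      LinearMap.rTensor H (twist W lam) D := by
    intro D
    induction D with
    | zero => simp
    | add a b ha hb => simp only [map_add, ha, hb]
    | tmul a b =>
      rw [LinearMap.rTensor_tmul, LinearMap.rTensor_tmul, h0]
      induction W.comul a with
      | zero => simp
      | add c d hc hd => simp only [add_tmul, map_add, hc, hd]
      | tmul c d => simp [Θ, smul_tmul]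
  rw [← h1, ← W.coassoc, h2]

theorem twist_εt_twist (hcoc : W.Cocomm)
    (hlam3 : ∀ h g : H, lam (h * g) = lam h * lam g) (h : H) :
    twist W lam (W.εt (twist W lam h)) = lam h • twist W lam 1 := by
  have h1 : ∀ D : H ⊗[k] H,
      twist W lam (TensorProduct.lid k H (LinearMap.rTensor H
        (W.counit ∘ₗ LinearMap.mulRight k (twist W lam h)) D)) =
      TensorProduct.lid k H (LinearMap.rTensor H
        (W.counit ∘ₗ LinearMap.mulRight k (twist W lam h))
          (LinearMap.lTensor H (twist W lam) D)) := by
    intro D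
    induction D with
    | zero => simp
    | add a b ha hb => simp only [map_add, ha, hb]
    | tmul a b => simp
  rw [W.εt_apply, h1, lTensor_twist_comul W lam hcoc, twist_apply W lam 1]
  induction W.comul 1 with
  | zero => simp
  | add a b ha hb => simp only [map_add, smul_add, ha, hb]
  | tmul a b => simp [← twist_mul W lam hlam3, counit_twist, hlam3, smul_smul, mul_comm]

theorem twist_mul_twist_of_isLeftIntegral (hcoc : W.Cocomm)
    (hlam2 : ∀ h : H, LinearMap.mul' k k (TensorProduct.map lam lam (W.comul h)) = lam h)
    (hlam3 : ∀ h g : H, lam (h * g) = lam h * lam g) {t : H} (ht : W.IsLeftIntegral t) (h : H) :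
    twist W lam h * twist W lam t = lam h • twist W lam t := by
  rw [← twist_twist W lam hlam2 h, ← twist_mul W lam hlam3, ht, twist_mul W lam hlam3,
    twist_εt_twist W lam hcoc hlam3, smul_mul_assoc, ← twist_mul W lam hlam3, one_mul]

end Twist

section Smash

variable {k H A : Type*} [Field k] [Ring H] [Algebra k H] [Ring A] [Algebra k A]
  (WH : WeakBialgebra k H) (WA : WeakBialgebra k A) (lam : H →ₗ[k] k)

theorem smashMul_lsmul_tmul (x y : A) (h g : H) :
    smashMul k WH (LinearMap.lsmul k A ∘ₗ lam) ((x ⊗ₜ h) ⊗ₜ (y ⊗ₜ g)) =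
      (x * y) ⊗ₜ (twist WH lam h * g) := by
  rw [twist_apply]
  simp only [smashMul, LinearMap.comp_apply, LinearMap.rTensor_tmul, LinearMap.lTensor_tmul,
    LinearEquiv.coe_coe, TensorProduct.assoc_tmul]
  induction WH.comul h with
  | zero => simp
  | add a b ha hb => simp only [add_tmul, tmul_add, map_add, add_mul, ha, hb]
  | tmul a b => simp [smul_tmul]

variable {WA} {S : A →ₗ[k] A} {z : A}

theorem projBar_flip_mk_tmul (hS : WA.IsAntipode S)
    (hcomm : ∀ a b : A, a * b = b * a) (hz1 : WA.counit z = 1) (hz2 : z * z = z)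
    (hz3 : WA.comul z = z ⊗ₜ[k] z) (x : A) (h : H) :
    projBar k WH WA ((TensorProduct.mk k H A).flip z) (x ⊗ₜ h) = (x * z) ⊗ₜ h := by
  rw [← WeakBialgebra.comul_counit_mul_groupLike hS hcomm hz1 hz2 hz3 x]
  conv_rhs => rw [← WH.comul_counit h]
  simp only [projBar, smashComul, LinearMap.comp_apply, LinearEquiv.coe_coe,
    TensorProduct.map_tmul]
  induction WA.comul x with
  | zero => simp
  | add a b ha hb => simp only [add_tmul, map_add, ha, hb]
  | tmul a b =>
    induction WH.comul h with
    | zero => simp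
    | add c d hc hd => simp only [tmul_add, map_add, hc, hd]
    | tmul c d => simp [smashCounit, smul_tmul, smul_smul, mul_comm]

theorem projBoth_lsmul_flip_mk_tmul (hS : WA.IsAntipode S)
    (hcomm : ∀ a b : A, a * b = b * a) (hz1 : WA.counit z = 1) (hz2 : z * z = z)
    (hz3 : WA.comul z = z ⊗ₜ[k] z) (x : A) (h : H) :
    projBoth k WH WA (LinearMap.lsmul k A ∘ₗ lam) ((TensorProduct.mk k H A).flip z)
      (x ⊗ₜ h) = (x * z) ⊗ₜ twist WH lam h := by
  rw [projBoth, LinearMap.comp_apply, projUnder, LinearMap.comp_apply, LinearMap.flip_apply,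
    TensorProduct.mk_apply, smashMul_lsmul_tmul, mul_one, mul_one,
    projBar_flip_mk_tmul WH hS hcomm hz1 hz2 hz3]

theorem smashEpsT_lsmul_flip_mk_tmul (hS : WA.IsAntipode S)
    (hcomm : ∀ a b : A, a * b = b * a) (hz1 : WA.counit z = 1) (hz2 : z * z = z)
    (hz3 : WA.comul z = z ⊗ₜ[k] z)
    (hlam2 : ∀ h : H, LinearMap.mul' k k (TensorProduct.map lam lam (WH.comul h)) = lam h)
    (hlam3 : ∀ h g : H, lam (h * g) = lam h * lam g) (x : A) (h : H) :
    smashEpsT k WH WA (LinearMap.lsmul k A ∘ₗ lam) ((TensorProduct.mk k H A).flip z)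
      ((x * z) ⊗ₜ twist WH lam h) =
        (WA.counit (x * z) * lam h) • (z ⊗ₜ twist WH lam 1) := by
  have hx : z * (x * z) = x * z := by rw [hcomm, mul_assoc, hz2]
  rw [smashEpsT, smashOne, projBoth_lsmul_flip_mk_tmul WH lam hS hcomm hz1 hz2 hz3, one_mul]
  conv_rhs => rw [← twist_twist WH lam hlam2 1, twist_apply WH lam (twist WH lam 1)]
  simp only [smashComul, LinearMap.comp_apply, TensorProduct.map_tmul, hz3]
  induction WH.comul (twist WH lam 1) with
  | zero => simp
  | add a b ha hb => simp only [tmul_add, map_add, smul_add, ha, hb]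
  | tmul a b =>
    simp [smashMul_lsmul_tmul, smashCounit, hx, hz2, ← twist_mul WH lam hlam3, counit_twist,
      hlam3, smul_smul, mul_comm, mul_assoc, mul_left_comm]

theorem integralWitness_lsmul_flip_mk (t : H) :
    integralWitness k WH WA (LinearMap.lsmul k A ∘ₗ lam) ((TensorProduct.mk k H A).flip z) t =
      WA.εs z ⊗ₜ TensorProduct.rid k H (LinearMap.lTensor H lam (WH.comul t)) := by
  simp only [integralWitness]
  induction WH.comul t with
  | zero => simp
  | add a b ha hb => simp only [tmul_add, map_add, ha, hb]
  | tmul a b => simp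

end Smash

theorem lambda_z_leftIntegral
    {k H A : Type*} [Field k] [Ring H] [Algebra k H] [Ring A] [Algebra k A]
    (WH : WeakBialgebra k H) (WA : WeakBialgebra k A)
    (SH : H →ₗ[k] H) (SA : A →ₗ[k] A)
    (hSH : WH.IsAntipode SH) (hSA : WA.IsAntipode SA)
    (hcoc : WH.Cocomm) (hcomm : ∀ a b : A, a * b = b * a)
    (lam : H →ₗ[k] k) (z : A)
    (hlam1 : lam 1 = 1)
    (hlam2 : ∀ h : H,
      LinearMap.mul' k k ((TensorProduct.map lam lam) (WH.comul h)) = lam h)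
    (hlam3 : ∀ h g : H, lam (h * g) = lam h * lam g)
    (hz1 : WA.counit z = 1) (hz2 : z * z = z) (hz3 : WA.comul z = z ⊗ₜ[k] z)
    (α : A) (t : H) (hα : WA.IsLeftIntegral α) (ht : WH.IsLeftIntegral t) :
    (∀ h : H,
      (LinearMap.rTensor H (LinearMap.mulLeft k ((LinearMap.lsmul k A ∘ₗ lam) h α)))
          (integralWitness k WH WA (LinearMap.lsmul k A ∘ₗ lam)
            ((TensorProduct.mk k H A).flip z) t) =
        (LinearMap.rTensor H
            (LinearMap.mulLeft k
              (LinearMap.mul' k A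
                  ((TensorProduct.map ((LinearMap.lsmul k A ∘ₗ lam).flip 1) WA.εs)
                    (((TensorProduct.mk k H A).flip z) h)) * α)))
          (integralWitness k WH WA (LinearMap.lsmul k A ∘ₗ lam)
            ((TensorProduct.mk k H A).flip z) t)) ∧
    projBoth k WH WA (LinearMap.lsmul k A ∘ₗ lam) ((TensorProduct.mk k H A).flip z)
        (α ⊗ₜ[k] t) =
      (α * z) ⊗ₜ[k] ((TensorProduct.lid k H) ((LinearMap.rTensor H lam) (WH.comul t))) ∧
    ∀ (x : A) (h : H),
      smashMul k WH (LinearMap.lsmul k A ∘ₗ lam)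
          (projBoth k WH WA (LinearMap.lsmul k A ∘ₗ lam)
              ((TensorProduct.mk k H A).flip z) (x ⊗ₜ[k] h) ⊗ₜ[k]
            projBoth k WH WA (LinearMap.lsmul k A ∘ₗ lam)
              ((TensorProduct.mk k H A).flip z) (α ⊗ₜ[k] t)) =
        smashMul k WH (LinearMap.lsmul k A ∘ₗ lam)
          (smashEpsT k WH WA (LinearMap.lsmul k A ∘ₗ lam)
              ((TensorProduct.mk k H A).flip z)
              (projBoth k WH WA (LinearMap.lsmul k A ∘ₗ lam)
                ((TensorProduct.mk k H A).flip z) (x ⊗ₜ[k] h)) ⊗ₜ[k]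
            projBoth k WH WA (LinearMap.lsmul k A ∘ₗ lam)
              ((TensorProduct.mk k H A).flip z) (α ⊗ₜ[k] t)) := by
  have hεs := WeakBialgebra.εs_eq_self_of_comul_eq hSA hcomm hz1 hz2 hz3
  have hproj := projBoth_lsmul_flip_mk_tmul WH lam hSA hcomm hz1 hz2 hz3
  refine ⟨fun h => ?_, hproj α t, fun x h => ?_⟩
  · rw [integralWitness_lsmul_flip_mk, hεs, LinearMap.rTensor_tmul, LinearMap.rTensor_tmul]
    congr 1
    simp [hεs, hcomm z α, mul_assoc, hz2]
  · rw [hproj, hproj,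
      smashEpsT_lsmul_flip_mk_tmul WH lam hSA hcomm hz1 hz2 hz3 hlam2 hlam3,
      ← smul_tmul', map_smul, smashMul_lsmul_tmul, smashMul_lsmul_tmul,
      twist_twist WH lam hlam2, twist_twist WH lam hlam2,
      twist_mul_twist_of_isLeftIntegral WH lam hcoc hlam2 hlam3 ht, ← twist_mul WH lam hlam3,
      one_mul]
    have hA : x * z * (α * z) = WA.counit (x * z) • (z * (α * z)) :=
      calc x * z * (α * z) = x * α * z := by
            rw [hcomm α z, ← mul_assoc, mul_assoc x z z, hz2, mul_assoc, mul_assoc, hcomm z α]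
        _ = WA.εt x * z * (α * z) := by
            rw [hα, hcomm α z, ← mul_assoc, mul_assoc (WA.εt x) z z, hz2, mul_assoc, mul_assoc,
              hcomm z α]
        _ = _ := by
            rw [WeakBialgebra.εt_mul_groupLike hcomm hz3, smul_mul_assoc]
    rw [hA, tmul_smul, ← smul_tmul', smul_smul, mul_comm]

end WeakSmash
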